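/- arXiv:1812.04343 — 7 statements merged into one kernel-verified Lean document; each statement's English description precedes it below -/
import Mathlib

section
/- Let f be a continuous density on ℝ^d, let P_X be the probability measure on ℝ^d with density f, and for each k let f_{1,k},…,f_{M,k} : ℝ^d → ℝ be continuous functions such that f_{m,k}(y) → f(y) as k → ∞ for μ-almost every y and for y = x, for each m. Fix ε > 0 and set B_k(ε,x) = {y : |f_{m,k}(y) − f_{m,k}(x)| < ε for all m}. Assume that μ[B*(ε+γ,x) ∖ B*(ε−γ,x)] → 0 as γ → 0, that the closure of B*(ε,x) is compact, and that the closure of B_k(ε,x) is compact for every k. Then P_X(B_k(ε,x)) → P_X(B*(ε,x)) as k → ∞. -/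
open MeasureTheory Filter Set

noncomputable section

/-- `B*(ε,x) = {y : |f(y) − f(x)| < ε}`. -/
def Bstar {d : ℕ} (f : EuclideanSpace ℝ (Fin d) → ℝ) (ε : ℝ) (x : EuclideanSpace ℝ (Fin d)) :
    Set (EuclideanSpace ℝ (Fin d)) :=
  {y | |f y - f x| < ε}

/-- `B(ε,x) = {y : |f_m(y) − f_m(x)| < ε for all m}` for a family `f_1,…,f_M`. -/
def Bfam {d M : ℕ} (g : Fin M → EuclideanSpace ℝ (Fin d) → ℝ) (ε : ℝ)
    (x : EuclideanSpace ℝ (Fin d)) : Set (EuclideanSpace ℝ (Fin d)) :=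
  {y | ∀ m, |g m y - g m x| < ε}

/-- If the shells `B*(ε+γ,x) ∖ B*(ε−γ,x)` shrink to measure zero, then the level set
`{y : |f(y) − f(x)| = ε}` is null. -/
theorem volume_levelSet_eq_zero {d : ℕ} {f : EuclideanSpace ℝ (Fin d) → ℝ}
    {x : EuclideanSpace ℝ (Fin d)} {ε : ℝ}
    (h : Tendsto (fun γ => volume (Bstar f (ε + γ) x \ Bstar f (ε - γ) x))
      (nhdsWithin 0 (Ioi 0)) (nhds 0)) :
    volume {y | |f y - f x| = ε} = 0 := by
  refine le_antisymm (ge_of_tendsto h ?_) zero_le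
  filter_upwards [self_mem_nhdsWithin] with γ hγ
  refine measure_mono fun y hy => ?_
  simp only [mem_Ioi, mem_ofPred_eq, Bstar, Set.mem_sdiff] at *
  constructor <;> linarith

/-- If the sets `A k` converge to `B` pointwise almost everywhere, then so do the integrals
of an integrable function over them. -/
theorem tendsto_setIntegral_of_ae_eventually_mem_iff {α : Type*} [MeasurableSpace α]
    {ν : Measure α} {f : α → ℝ} (hf : Integrable f ν) {A : ℕ → Set α} {B : Set α}
    (hA : ∀ k, MeasurableSet (A k)) (hB : MeasurableSet B)
    (h : ∀ᵐ y ∂ν, ∀ᶠ k in atTop, (y ∈ A k ↔ y ∈ B)) :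
    Tendsto (fun k => ∫ y in A k, f y ∂ν) atTop (nhds (∫ y in B, f y ∂ν)) := by
  simp only [← integral_indicator hB, ← integral_indicator (hA _)]
  refine tendsto_integral_of_dominated_convergence (fun y => ‖f y‖)
    (fun k => hf.aestronglyMeasurable.indicator (hA k)) hf.norm
    (fun k => Eventually.of_forall fun y => norm_indicator_le_norm_self f y) ?_
  filter_upwards [h] with y hy
  refine tendsto_const_nhds.congr' ?_
  filter_upwards [hy] with k hk
  by_cases hyB : y ∈ B
  · rw [indicator_of_mem hyB, indicator_of_mem (hk.2 hyB)]
  · rw [indicator_of_notMem hyB, indicator_of_notMem (mt hk.1 hyB)]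

/-- Lemma 2, second part: `P_X(B_k(ε,x)) → P_X(B*(ε,x))` as `k → ∞`. -/
theorem stmt3
    {d M : ℕ} (hM : 0 < M)
    -- f : a continuous density on ℝ^d
    (f : EuclideanSpace ℝ (Fin d) → ℝ) (hf_cont : Continuous f) (hf_nonneg : ∀ y, 0 ≤ f y)
    (hf_int : ∫ y, f y = 1)
    -- the continuous functions f_{m,k}
    (fk : ℕ → Fin M → EuclideanSpace ℝ (Fin d) → ℝ)
    (hfk_cont : ∀ k m, Continuous (fk k m))
    (x : EuclideanSpace ℝ (Fin d)) (ε : ℝ) (hε : 0 < ε)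
    -- f_{m,k}(y) → f(y) for μ-almost every y and at y = x
    (hconv_ae : ∀ᵐ y ∂(volume : Measure (EuclideanSpace ℝ (Fin d))),
      ∀ m, Tendsto (fun k => fk k m y) atTop (nhds (f y)))
    (hconv_x : ∀ m, Tendsto (fun k => fk k m x) atTop (nhds (f x)))
    -- μ[B*(ε+γ,x) ∖ B*(ε−γ,x)] → 0 as γ → 0
    (hbdry : Tendsto (fun γ => volume (Bstar f (ε + γ) x \ Bstar f (ε - γ) x))
      (nhdsWithin 0 (Ioi 0)) (nhds 0))
    -- compactness of the closures
    (hcpt_star : IsCompact (closure (Bstar f ε x)))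
    (hcpt_k : ∀ k, IsCompact (closure (Bfam (fk k) ε x))) :
    Tendsto (fun k => ∫ y in Bfam (fk k) ε x, f y) atTop
      (nhds (∫ y in Bstar f ε x, f y)) := by
  have hint : Integrable f := by
    by_contra h
    simp [integral_undef h] at hf_int
  have hopen (k : ℕ) : IsOpen (Bfam (fk k) ε x) := by
    simp only [Bfam, ofPred_forall]
    exact isOpen_iInter_of_finite fun m =>
      isOpen_lt ((hfk_cont k m).sub continuous_const).abs continuous_const
  have hopen_star : IsOpen (Bstar f ε x) :=
    isOpen_lt (hf_cont.sub continuous_const).abs continuous_const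
  refine tendsto_setIntegral_of_ae_eventually_mem_iff hint (fun k => (hopen k).measurableSet)
    hopen_star.measurableSet ?_
  have hne : ∀ᵐ y : EuclideanSpace ℝ (Fin d), |f y - f x| ≠ ε := by
    simpa [ae_iff] using volume_levelSet_eq_zero hbdry
  filter_upwards [hconv_ae, hne] with y hy hy_ne
  have hlim (m : Fin M) := ((hy m).sub (hconv_x m)).abs
  rcases hy_ne.lt_or_gt with hlt | hgt
  · filter_upwards [eventually_all.2 fun m => (hlim m).eventually_lt_const hlt] with k hk
    exact iff_of_true hk hlt
  · filter_upwards [(hlim ⟨0, hM⟩).eventually_const_lt hgt] with k hk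
    exact iff_of_false (fun h => (h ⟨0, hM⟩).not_gt hk) (not_lt.2 hgt.le)
end
end

section
/- Let f be a spherical density on ℝ^d, i.e. f(y) = h(‖y‖²) for some h : ℝ → ℝ, where h is strictly decreasing and h' is continuous on a neighbourhood of ‖x‖². Then for every x with f(x) > 0 and ‖∇f(x)‖ > 0, lim_{ε→0} μ(B*(ε,x))/(2ε) = 2π^{d/2}‖x‖^{d−1}/(Γ(d/2)‖∇f(x)‖), where Γ is Euler's gamma function. -/
open MeasureTheory Filter Set Real

noncomputable section

open scoped Topology

/-- The symmetric difference quotient of a differentiable function converges to the derivative. -/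
theorem HasDerivAt.tendsto_symmetric_slope {F : ℝ → ℝ} {F' c : ℝ} (hF : HasDerivAt F F' c) :
    Tendsto (fun ε => (F (c + ε) - F (c - ε)) / (2 * ε)) (𝓝[>] 0) (𝓝 F') := by
  have h₁ : HasDerivAt (fun ε => F (c + ε) - F (c - ε)) (2 * F') 0 := by
    have h₂ : HasDerivAt (fun ε => F (c + ε)) F' 0 :=
      HasDerivAt.comp_const_add c 0 (by simpa using hF)
    have h₃ : HasDerivAt (fun ε => F (c - ε)) (-F') 0 :=
      HasDerivAt.comp_const_sub c 0 (by simpa using hF)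
    exact (h₂.sub h₃).congr_deriv (by ring)
  have h₄ := (h₁.tendsto_slope.mono_left
    (nhdsWithin_mono 0 fun ε (hε : 0 < ε) => hε.ne')).const_mul (1 / 2)
  refine (h₄.congr fun ε => ?_).trans (by rw [one_div, inv_mul_cancel_left₀ two_ne_zero])
  simp only [slope_def_field, sub_zero, add_zero, sub_self]
  rw [div_mul_div_comm, one_mul]

/-- The volume of the open spherical shell with radii `a < b`. -/
theorem toReal_volume_ball_diff_closedBall {d : ℕ} (hd : 0 < d) {a b : ℝ} (ha : 0 ≤ a)
    (hab : a < b) :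
    (volume (Metric.ball (0 : EuclideanSpace ℝ (Fin d)) b \ Metric.closedBall 0 a)).toReal =
      (b ^ d - a ^ d) * (√π ^ d / Real.Gamma (d / 2 + 1)) := by
  have : Nonempty (Fin d) := ⟨⟨0, hd⟩⟩
  have hV : 0 ≤ √π ^ d / Real.Gamma (d / 2 + 1) :=
    div_nonneg (by positivity) (Real.Gamma_pos_of_pos (by positivity)).le
  rw [← measureReal_def,
    measureReal_sdiff (Metric.closedBall_subset_ball hab) measurableSet_closedBall, measureReal_def,
    measureReal_def, EuclideanSpace.volume_ball, EuclideanSpace.volume_closedBall]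
  simp only [Fintype.card_fin, ENNReal.toReal_mul, ENNReal.toReal_pow,
    ENNReal.toReal_ofReal hV, ENNReal.toReal_ofReal ha, ENNReal.toReal_ofReal (ha.trans hab.le)]
  ring

/-- The gradient of `y ↦ h (‖y‖ ^ 2)`. -/
theorem HasDerivAt.hasGradientAt_comp_norm_sq {E : Type*} [NormedAddCommGroup E]
    [InnerProductSpace ℝ E] [CompleteSpace E] {h : ℝ → ℝ} {h' : ℝ} {x : E}
    (hh : HasDerivAt h h' (‖x‖ ^ 2)) :
    HasGradientAt (fun y => h (‖y‖ ^ 2)) ((2 * h') • x) x := by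
  rw [hasGradientAt_iff_hasFDerivAt]
  refine (hh.comp_hasFDerivAt x (hasStrictFDerivAt_norm_sq x).hasFDerivAt).congr_fderiv ?_
  ext y
  simp
  ring

/-- For a spherical density `f(y) = h(‖y‖²)` with `h` strictly decreasing and `h'` continuous
near `‖x‖²`, if `f(x) > 0` and `‖∇f(x)‖ > 0` then
`lim_{ε→0} μ(B*(ε,x))/(2ε) = 2 π^{d/2} ‖x‖^{d−1} / (Γ(d/2) ‖∇f(x)‖)`. -/
theorem stmt8
    {d : ℕ} (hd : 0 < d)
    (f : EuclideanSpace ℝ (Fin d) → ℝ) (hf_nonneg : ∀ y, 0 ≤ f y)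
    (hf_int : ∫ y, f y = 1)
    (h : ℝ → ℝ)
    (hspher : ∀ y, f y = h (‖y‖ ^ 2))
    (hh_anti : StrictAnti h)
    (x : EuclideanSpace ℝ (Fin d))
    -- h' continuous on a neighbourhood of ‖x‖²
    (U : Set ℝ) (hU : U ∈ nhds (‖x‖ ^ 2)) (hh_diff : ∀ t ∈ U, DifferentiableAt ℝ h t)
    (hh_deriv_cont : ContinuousOn (deriv h) U)
    (hfx : 0 < f x) (hgrad : 0 < ‖gradient f x‖) :
    Tendsto (fun ε => (volume (Bstar f ε x)).toReal / (2 * ε))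
      (nhdsWithin 0 (Ioi 0))
      (nhds (2 * π ^ ((d : ℝ) / 2) * ‖x‖ ^ ((d : ℝ) - 1)
        / (Real.Gamma ((d : ℝ) / 2) * ‖gradient f x‖))) := by
  set t := ‖x‖ ^ 2 with ht
  set L := deriv h t
  have hh' : HasDerivAt h L t := (hh_diff t (mem_of_mem_nhds hU)).hasDerivAt
  have hgr : ‖gradient f x‖ = 2 * |L| * ‖x‖ := by
    rw [show f = fun y => h (‖y‖ ^ 2) from funext hspher, hh'.hasGradientAt_comp_norm_sq.gradient,
      norm_smul, norm_mul]
    simp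
  have hx : 0 < ‖x‖ := by
    refine (norm_nonneg x).lt_of_ne' fun h0 => ?_
    simp [hgr, h0] at hgrad
  have hL0 : L ≠ 0 := by
    intro h0
    simp [hgr, h0] at hgrad
  have hLneg : L < 0 := hh_anti.antitone.deriv_nonpos.lt_of_ne hL0
  have hstrict : HasStrictDerivAt h L t := by
    refine hasStrictDerivAt_of_hasDerivAt_of_continuousAt ?_ (hh_deriv_cont.continuousAt hU)
    filter_upwards [hU] with s hs using (hh_diff s hs).hasDerivAt
  set g := hstrict.localInverse h L t hL0
  have hgt : g (h t) = t := (hstrict.eventually_left_inverse hL0).self_of_nhds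
  have hg' : HasDerivAt g L⁻¹ (h t) := (hstrict.to_localInverse hL0).hasDerivAt
  have hsqrt : √t = ‖x‖ := Real.sqrt_sq hx.le
  have ht0 : 0 < t := by positivity
  have hρ : HasDerivAt (fun u => √(g u) ^ d * (√π ^ d / Real.Gamma (d / 2 + 1)))
      (d * ‖x‖ ^ (d - 1) * (L⁻¹ / (2 * ‖x‖)) * (√π ^ d / Real.Gamma (d / 2 + 1))) (h t) := by
    have := ((hg'.sqrt (by rw [hgt]; exact ht0.ne')).fun_pow d).mul_const
      (√π ^ d / Real.Gamma (d / 2 + 1))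
    rwa [hgt, hsqrt] at this
  have hlim := hρ.tendsto_symmetric_slope.neg
  have hgood : ∀ᶠ u in 𝓝 (h t), h (g u) = u ∧ 0 < g u :=
    (hstrict.eventually_right_inverse hL0).and
      (hg'.continuousAt.eventually (lt_mem_nhds (by rwa [hgt])))
  have hplus : ∀ᶠ ε in 𝓝[>] (0 : ℝ), h (g (h t + ε)) = h t + ε ∧ 0 < g (h t + ε) := by
    have : Tendsto (fun ε => h t + ε) (𝓝[>] 0) (𝓝 (h t)) :=
      Tendsto.mono_left (Continuous.tendsto' (by fun_prop) _ _ (by simp)) nhdsWithin_le_nhds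
    exact this.eventually hgood
  have hminus : ∀ᶠ ε in 𝓝[>] (0 : ℝ), h (g (h t - ε)) = h t - ε ∧ 0 < g (h t - ε) := by
    have : Tendsto (fun ε => h t - ε) (𝓝[>] 0) (𝓝 (h t)) :=
      Tendsto.mono_left (Continuous.tendsto' (by fun_prop) _ _ (by simp)) nhdsWithin_le_nhds
    exact this.eventually hgood
  have hval : -(d * ‖x‖ ^ (d - 1) * (L⁻¹ / (2 * ‖x‖)) * (√π ^ d / Real.Gamma (d / 2 + 1))) =
      2 * π ^ ((d : ℝ) / 2) * ‖x‖ ^ ((d : ℝ) - 1)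
        / (Real.Gamma ((d : ℝ) / 2) * ‖gradient f x‖) := by
    have hd0 : (0 : ℝ) < d := by exact_mod_cast hd
    have hΓ : 0 < Real.Gamma ((d : ℝ) / 2) := Real.Gamma_pos_of_pos (by positivity)
    have hpow : ‖x‖ ^ ((d : ℝ) - 1) = ‖x‖ ^ (d - 1) := by
      rw [← Real.rpow_natCast, Nat.cast_pred hd]
    have hpi : √π ^ d = π ^ ((d : ℝ) / 2) := by
      rw [Real.sqrt_eq_rpow, ← Real.rpow_mul_natCast Real.pi_pos.le, one_div_mul_eq_div]
    rw [hgr, abs_of_neg hLneg, Real.Gamma_add_one (by positivity), hpow, hpi]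
    field_simp
  rw [← hval]
  refine hlim.congr' ?_
  filter_upwards [hplus, hminus, self_mem_nhdsWithin] with ε ⟨hp, hp0⟩ ⟨hm, hm0⟩ (hε : 0 < ε)
  have hlt : g (h t + ε) < g (h t - ε) := by
    rw [← hh_anti.lt_iff_gt, hp, hm]
    linarith
  have hset : Bstar f ε x =
      Metric.ball 0 √(g (h t - ε)) \ Metric.closedBall 0 √(g (h t + ε)) := by
    ext y
    have h₁ : ‖y‖ < √(g (h t - ε)) ↔ h t - ε < h (‖y‖ ^ 2) := by
      rw [Real.lt_sqrt (norm_nonneg y), ← hh_anti.lt_iff_gt, hm]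
    have h₂ : √(g (h t + ε)) < ‖y‖ ↔ h (‖y‖ ^ 2) < h t + ε := by
      rw [Real.sqrt_lt hp0.le (norm_nonneg y), ← hh_anti.lt_iff_gt, hp]
    simp only [Bstar, mem_ofPred_eq, hspher, ← ht, Set.mem_sdiff, mem_ball_zero_iff,
      mem_closedBall_zero_iff, not_le, h₁, h₂, abs_lt]
    constructor <;> rintro ⟨h₃, h₄⟩ <;> constructor <;> linarith
  rw [hset, toReal_volume_ball_diff_closedBall hd (Real.sqrt_nonneg _)
    (Real.sqrt_lt_sqrt hp0.le hlt)]
  ring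
end
end

section
/- Let X be a random vector with density f satisfying P(f(X) = a) = 0 for all a ∈ ℝ, and let {f_i} be measurable functions with f_i(X) → f(X) almost surely. Fix a < b and set B = {ω : f(X(ω)) ∈ [a,b]} and, for each i, A_i = ∩_{r=1}^∞ {ω : f_i(X(ω)) ∈ [a − 1/r, b + 1/r]}. Then A_i belongs to the σ-algebra generated by f_i(X) and P(A_i △ B) → 0 as i → ∞; consequently the σ-algebras σ(f_i(X)) P-approach σ(f(X)): for every B ∈ σ(f(X)) there exist A_i ∈ σ(f_i(X)) with P(A_i △ B) → 0. -/
open MeasureTheory Filter Set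

noncomputable section

/-- If `Y i → Y` almost surely and `Y` almost surely avoids the frontier of `T`, then the events
`{Y i ∈ T}` converge to `{Y ∈ T}` in measure. -/
theorem tendsto_measure_symmDiff_preimage_of_null_frontier {Ω E : Type*} [MeasurableSpace Ω]
    {P : Measure Ω} [IsFiniteMeasure P] [TopologicalSpace E] [MeasurableSpace E]
    {Y : Ω → E} {Yi : ℕ → Ω → E} (hY : Measurable Y) (hYi : ∀ i, Measurable (Yi i))
    (hconv : ∀ᵐ ω ∂P, Tendsto (fun i => Yi i ω) atTop (nhds (Y ω)))
    {T : Set E} (hT : MeasurableSet T) (hfr : P (Y ⁻¹' frontier T) = 0) :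
    Tendsto (fun i => P (symmDiff (Yi i ⁻¹' T) (Y ⁻¹' T))) atTop (nhds 0) := by
  rw [← measure_empty (μ := P)]
  refine tendsto_measure_of_ae_tendsto_indicator_of_isFiniteMeasure atTop MeasurableSet.empty
    (fun i => (hYi i hT).symmDiff (hY hT)) ?_
  have hfr' : ∀ᵐ ω ∂P, Y ω ∉ frontier T := measure_eq_zero_iff_ae_notMem.1 hfr
  filter_upwards [hconv, hfr'] with ω hω hωT
  by_cases hmem : Y ω ∈ T
  · have hint : Y ω ∈ interior T := by
      by_contra h
      exact hωT ⟨subset_closure hmem, h⟩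
    filter_upwards [hω (mem_interior_iff_mem_nhds.1 hint)] with i hi
    have hi' : Yi i ω ∈ T := hi
    simp [mem_symmDiff, hmem, hi']
  · have hcl : Y ω ∉ closure T := fun h => hωT ⟨h, fun h' => hmem (interior_subset h')⟩
    filter_upwards [hω (isClosed_closure.isOpen_compl.mem_nhds hcl)] with i hi
    have hi' : Yi i ω ∉ T := fun h => hi (subset_closure h)
    simp [mem_symmDiff, hmem, hi']

/-- Borel sets are approximated in measure by Borel sets with null frontier. -/
theorem exists_null_frontier_measure_symmDiff_lt {E : Type*} [MetricSpace E] [CompleteSpace E]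
    [SecondCountableTopology E] [MeasurableSpace E] [BorelSpace E] (μ : Measure E)
    [IsFiniteMeasure μ] {S : Set E} (hS : MeasurableSet S) {ε : ENNReal} (hε : ε ≠ 0) :
    ∃ T, MeasurableSet T ∧ μ (frontier T) = 0 ∧ μ (symmDiff T S) < ε := by
  have hε2 : ε / 2 ≠ 0 := (ENNReal.half_pos hε).ne'
  obtain ⟨K, hKS, hK, hKlt⟩ := hS.exists_isCompact_sdiff_lt (measure_ne_top μ S) hε2
  obtain ⟨U, hSU, hU, -, hUlt⟩ := hS.exists_isOpen_sdiff_lt (measure_ne_top μ S) hε2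
  obtain ⟨δ, hδ, hδU⟩ := hK.exists_thickening_subset_open hU (hKS.trans hSU)
  obtain ⟨r, ⟨hr, hrδ⟩, hnull⟩ := exists_null_frontier_thickening μ K hδ
  refine ⟨Metric.thickening r K, Metric.isOpen_thickening.measurableSet, hnull, ?_⟩
  have hTU : Metric.thickening r K ⊆ U := (Metric.thickening_mono hrδ.le K).trans hδU
  have hKT : K ⊆ Metric.thickening r K := Metric.self_subset_thickening hr K
  calc μ (symmDiff (Metric.thickening r K) S)
      ≤ μ ((U \ S) ∪ (S \ K)) :=
        measure_mono (union_subset_union (sdiff_subset_sdiff_left hTU) (sdiff_subset_sdiff_right hKT))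
    _ ≤ μ (U \ S) + μ (S \ K) := measure_union_le _ _
    _ < ε / 2 + ε / 2 := ENNReal.add_lt_add hUlt hKlt
    _ = ε := ENNReal.add_halves ε

/-- If `Y i → Y` almost surely, then every event `{Y ∈ S}` is a limit in measure of events
`{Y i ∈ T i}`. -/
theorem exists_tendsto_measure_symmDiff_preimage {Ω E : Type*} [MeasurableSpace Ω]
    {P : Measure Ω} [IsFiniteMeasure P] [MetricSpace E] [CompleteSpace E]
    [SecondCountableTopology E] [MeasurableSpace E] [BorelSpace E]
    {Y : Ω → E} {Yi : ℕ → Ω → E} (hY : Measurable Y) (hYi : ∀ i, Measurable (Yi i))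
    (hconv : ∀ᵐ ω ∂P, Tendsto (fun i => Yi i ω) atTop (nhds (Y ω)))
    {S : Set E} (hS : MeasurableSet S) :
    ∃ T : ℕ → Set E, (∀ i, MeasurableSet (T i)) ∧
      Tendsto (fun i => P (symmDiff (Yi i ⁻¹' T i) (Y ⁻¹' S))) atTop (nhds 0) := by
  let e : ℕ → ENNReal := fun i =>
    ⨅ T : {T : Set E // MeasurableSet T}, P (symmDiff (Yi i ⁻¹' T) (Y ⁻¹' S))
  have hle : ∀ i (T : {T : Set E // MeasurableSet T}),
      e i ≤ P (symmDiff (Yi i ⁻¹' T) (Y ⁻¹' S)) := fun i => iInf_le _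
  have he : Tendsto e atTop (nhds 0) := by
    rw [ENNReal.tendsto_nhds_zero]
    intro ε hε
    have hε2 : 0 < ε / 2 := ENNReal.half_pos hε.ne'
    obtain ⟨T, hT, hfr, hTS⟩ :=
      exists_null_frontier_measure_symmDiff_lt (Measure.map Y P) hS hε2.ne'
    rw [Measure.map_apply hY isClosed_frontier.measurableSet] at hfr
    rw [Measure.map_apply hY (hT.symmDiff hS)] at hTS
    have hlim := tendsto_measure_symmDiff_preimage_of_null_frontier hY hYi hconv hT hfr
    filter_upwards [ENNReal.tendsto_nhds_zero.1 hlim _ hε2] with i hi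
    calc e i ≤ P (symmDiff (Yi i ⁻¹' T) (Y ⁻¹' S)) := hle i ⟨T, hT⟩
      _ ≤ P (symmDiff (Yi i ⁻¹' T) (Y ⁻¹' T)) + P (symmDiff (Y ⁻¹' T) (Y ⁻¹' S)) :=
          measure_symmDiff_le _ _ _
      _ ≤ ε / 2 + ε / 2 := add_le_add hi hTS.le
      _ = ε := ENNReal.add_halves ε
  have hne : ∀ i, e i ≠ ⊤ := fun i =>
    ((hle i ⟨∅, MeasurableSet.empty⟩).trans_lt (measure_lt_top P _)).ne
  have hex : ∀ i : ℕ, ∃ T : {T : Set E // MeasurableSet T},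
      P (symmDiff (Yi i ⁻¹' T) (Y ⁻¹' S)) < e i + (i : ENNReal)⁻¹ := fun i =>
    iInf_lt_iff.1 (ENNReal.lt_add_right (hne i) (by simp))
  choose T hT using hex
  refine ⟨fun i => T i, fun i => (T i).2, ?_⟩
  refine tendsto_of_tendsto_of_tendsto_of_le_of_le tendsto_const_nhds ?_
    (fun i => zero_le) (fun i => (hT i).le)
  simpa using he.add ENNReal.tendsto_inv_nat_nhds_zero

theorem iInter_Icc_sub_add_one_div (a b : ℝ) :
    ⋂ r : ℕ, Icc (a - 1 / ((r : ℝ) + 1)) (b + 1 / ((r : ℝ) + 1)) = Icc a b := by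
  ext x
  simp only [mem_iInter, mem_Icc]
  have hlim := tendsto_one_div_add_atTop_nhds_zero_nat (𝕜 := ℝ)
  constructor
  · intro h
    constructor
    · simpa using le_of_tendsto' (hlim.const_sub a) fun r => (h r).1
    · simpa using ge_of_tendsto' (hlim.const_add b) fun r => (h r).2
  · intro h r
    have : (0 : ℝ) ≤ 1 / ((r : ℝ) + 1) := by positivity
    constructor <;> linarith [h.1, h.2]

/-- The σ-algebras σ(f_i(X)) P-approach σ(f(X)): the explicit sets
`A_i = ∩_r {f_i(X) ∈ [a − 1/r, b + 1/r]}` are σ(f_i(X))-measurable and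
`P(A_i △ B) → 0` for `B = {f(X) ∈ [a,b]}`; consequently, for every `B` in σ(f(X))
there are `A_i` in σ(f_i(X)) with `P(A_i △ B) → 0`. -/
theorem stmt9
    {d : ℕ}
    {Ω : Type*} [MeasurableSpace Ω] (P : Measure Ω) [IsProbabilityMeasure P]
    -- X : a random vector in ℝ^d with density f
    (X : Ω → EuclideanSpace ℝ (Fin d)) (hX : Measurable X)
    (f : EuclideanSpace ℝ (Fin d) → ℝ) (hf : Measurable f) (hf_nonneg : ∀ y, 0 ≤ f y)
    (hdens : Measure.map X P
      = (volume : Measure (EuclideanSpace ℝ (Fin d))).withDensity (fun y => ENNReal.ofReal (f y)))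
    -- condition K1
    (hK1 : ∀ a : ℝ, P {ω | f (X ω) = a} = 0)
    -- measurable functions f_i with f_i(X) → f(X) a.s.
    (fi : ℕ → EuclideanSpace ℝ (Fin d) → ℝ) (hfi : ∀ i, Measurable (fi i))
    (hconv : ∀ᵐ ω ∂P, Tendsto (fun i => fi i (X ω)) atTop (nhds (f (X ω))))
    (a b : ℝ) (hab : a < b) :
    (∀ i, MeasurableSet[MeasurableSpace.comap (fun ω => fi i (X ω)) inferInstance]
        (⋂ r : ℕ, {ω | fi i (X ω) ∈ Icc (a - 1 / (r + 1)) (b + 1 / (r + 1))})) ∧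
    Tendsto
      (fun i => P (symmDiff
        (⋂ r : ℕ, {ω | fi i (X ω) ∈ Icc (a - 1 / (r + 1)) (b + 1 / (r + 1))})
        {ω | f (X ω) ∈ Icc a b}))
      atTop (nhds 0) ∧
    (∀ B : Set Ω, MeasurableSet[MeasurableSpace.comap (fun ω => f (X ω)) inferInstance] B →
      ∃ A : ℕ → Set Ω,
        (∀ i, MeasurableSet[MeasurableSpace.comap (fun ω => fi i (X ω)) inferInstance] (A i)) ∧
        Tendsto (fun i => P (symmDiff (A i) B)) atTop (nhds 0)) := by
  have hset : ∀ i, (⋂ r : ℕ, {ω | fi i (X ω) ∈ Icc (a - 1 / ((r : ℝ) + 1)) (b + 1 / (r + 1))})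
      = (fun ω => fi i (X ω)) ⁻¹' Icc a b := fun i => by
    rw [← iInter_Icc_sub_add_one_div a b, preimage_iInter]
    rfl
  have hY : Measurable fun ω => f (X ω) := hf.comp hX
  have hYi : ∀ i, Measurable fun ω => fi i (X ω) := fun i => (hfi i).comp hX
  simp only [hset]
  refine ⟨fun i => ⟨_, measurableSet_Icc, rfl⟩, ?_, ?_⟩
  · refine tendsto_measure_symmDiff_preimage_of_null_frontier hY hYi hconv measurableSet_Icc ?_
    rw [frontier_Icc hab.le]
    exact measure_union_null (hK1 a) (hK1 b)
  · rintro _ ⟨S, hS, rfl⟩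
    obtain ⟨T, hT, hlim⟩ := exists_tendsto_measure_symmDiff_preimage hY hYi hconv hS
    exact ⟨fun i => (fun ω => fi i (X ω)) ⁻¹' T i, fun i => ⟨T i, hT i, rfl⟩, hlim⟩
end
end

section
/- Let f be a bounded continuous density on ℝ^d and let x be such that for every sufficiently small ε > 0 the closure of B*(ε,x) is compact, μ(B*(ε,x)) > 0, and μ[B*(ε+γ,x) ∖ B*(ε−γ,x)] → 0 as γ → 0. For each k let B_k(ε,x) be measurable sets with μ(B_k(ε,x)) → μ(B*(ε,x)) and ∫_{B_k(ε,x)} f dμ → ∫_{B*(ε,x)} f dμ as k → ∞. Then lim_{ε→0} lim_{k→∞} (1/μ(B_k(ε,x))) ∫_{B_k(ε,x)} f(t) dt = f(x). -/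
open MeasureTheory Filter Set

noncomputable section

/-- `lim_{ε→0} lim_{k→∞} (1/μ(B_k(ε,x))) ∫_{B_k(ε,x)} f = f(x)`, stated in iterated ε–δ form. -/
theorem stmt12
    {d : ℕ}
    -- f : a bounded continuous density on ℝ^d
    (f : EuclideanSpace ℝ (Fin d) → ℝ) (hf_cont : Continuous f) (hf_nonneg : ∀ y, 0 ≤ f y)
    (hf_int : ∫ y, f y = 1) (hf_bdd : ∃ C, ∀ y, f y ≤ C)
    (x : EuclideanSpace ℝ (Fin d))
    (ε₀ : ℝ) (hε₀ : 0 < ε₀)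
    -- regularity of B*(ε,x) for all sufficiently small ε
    (hcpt : ∀ ε : ℝ, 0 < ε → ε < ε₀ → IsCompact (closure (Bstar f ε x)))
    (hpos : ∀ ε : ℝ, 0 < ε → ε < ε₀ → 0 < volume (Bstar f ε x))
    (hbdry : ∀ ε : ℝ, 0 < ε → ε < ε₀ →
      Tendsto (fun γ => volume (Bstar f (ε + γ) x \ Bstar f (ε - γ) x))
        (nhdsWithin 0 (Ioi 0)) (nhds 0))
    -- the approximating measurable sets B_k(ε,x)
    (B : ℕ → ℝ → Set (EuclideanSpace ℝ (Fin d)))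
    (hB_meas : ∀ k ε, MeasurableSet (B k ε))
    (hB_vol : ∀ ε : ℝ, 0 < ε → ε < ε₀ →
      Tendsto (fun k => volume (B k ε)) atTop (nhds (volume (Bstar f ε x))))
    (hB_int : ∀ ε : ℝ, 0 < ε → ε < ε₀ →
      Tendsto (fun k => ∫ t in B k ε, f t) atTop (nhds (∫ t in Bstar f ε x, f t))) :
    ∀ δ > (0 : ℝ), ∃ ε₁ > (0 : ℝ), ∀ ε : ℝ, 0 < ε → ε < ε₁ →
      ∃ k₀ : ℕ, ∀ k ≥ k₀,
        |(1 / (volume (B k ε)).toReal) * (∫ t in B k ε, f t) - f x| < δ := by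
  intro δ hδ
  refine ⟨min ε₀ δ, lt_min hε₀ hδ, fun ε hε hε₁ => ?_⟩
  have hεε₀ : ε < ε₀ := hε₁.trans_le (min_le_left _ _)
  have hεδ : ε < δ := hε₁.trans_le (min_le_right _ _)
  have hfin : volume (Bstar f ε x) < ⊤ :=
    (measure_mono subset_closure).trans_lt (hcpt ε hε hεε₀).measure_lt_top
  have hvol : 0 < volume.real (Bstar f ε x) :=
    ENNReal.toReal_pos (hpos ε hε hεε₀).ne' hfin.ne
  have hf : Integrable f := by
    by_contra h
    simp [integral_undef h] at hf_int
  have hsub : ∫ t in Bstar f ε x, (f t - f x) =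
      (∫ t in Bstar f ε x, f t) - volume.real (Bstar f ε x) * f x := by
    rw [integral_sub hf.integrableOn (integrableOn_const hfin.ne), setIntegral_const, smul_eq_mul]
  have hbound : |∫ t in Bstar f ε x, (f t - f x)| ≤ ε * volume.real (Bstar f ε x) := by
    rw [← Real.norm_eq_abs]
    exact norm_setIntegral_le_of_norm_le_const hfin fun t (ht : |f t - f x| < ε) => ht.le
  have havg : |1 / volume.real (Bstar f ε x) * (∫ t in Bstar f ε x, f t) - f x| < δ := by
    have heq : 1 / volume.real (Bstar f ε x) * (∫ t in Bstar f ε x, f t) - f x =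
        (∫ t in Bstar f ε x, (f t - f x)) / volume.real (Bstar f ε x) := by
      rw [hsub]
      field_simp
    rw [heq, abs_div, abs_of_pos hvol]
    exact ((div_le_iff₀ hvol).2 hbound).trans_lt hεδ
  have hlim : Tendsto (fun k => |1 / (volume (B k ε)).toReal * (∫ t in B k ε, f t) - f x|) atTop
      (nhds |1 / volume.real (Bstar f ε x) * (∫ t in Bstar f ε x, f t) - f x|) :=
    (((tendsto_const_nhds.div ((ENNReal.tendsto_toReal hfin.ne).comp (hB_vol ε hε hεε₀))
      hvol.ne').mul (hB_int ε hε hεε₀)).sub_const _).abs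
  exact eventually_atTop.1 (hlim.eventually_lt_const havg)
end
end

section
/- Let f be a bounded continuous density on ℝ^d, let K : ℝ → [0, c₂] be a bounded continuous kernel satisfying lim_{ε→0} (1/μ(B*(ε,x))) ∫_{B*(ε,x)} K[(f(t) − f(x))/ε]^M dt = 1, and let x be such that for every sufficiently small ε > 0, 0 < μ(B*(ε,x)) < ∞. For each k let f_{1,k},…,f_{M,k} be continuous functions converging to f μ-almost everywhere and at x, with associated sets B_k(ε,x) = {y : |f_{m,k}(y) − f_{m,k}(x)| < ε for all m} satisfying μ(B_k(ε,x)) → μ(B*(ε,x)) as k → ∞. Then lim_{ε→0} lim_{k→∞} (1/μ(B_k(ε,x))) ∫_{B_k(ε,x)} Π_{m=1}^M K[(f_{m,k}(t) − f_{m,k}(x))/ε] f(t) dt = f(x). -/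
open MeasureTheory Filter Set

noncomputable section

/-- Integrals of uniformly bounded functions over varying sets converge, provided the sets
eventually contain almost every point of a limit set of finite measure and their measures converge
to the measure of that set. -/
theorem tendsto_setIntegral_of_tendsto_measure {α : Type*} [MeasurableSpace α] {μ : Measure α}
    {A : Set α} {B : ℕ → Set α} {H : α → ℝ} {G : ℕ → α → ℝ} {C : ℝ}
    (hA : MeasurableSet A) (hB : ∀ k, MeasurableSet (B k)) (hA_fin : μ A ≠ ⊤)
    (hmem : ∀ᵐ y ∂μ.restrict A, ∀ᶠ k in atTop, y ∈ B k)
    (hmeas : Tendsto (fun k => μ (B k)) atTop (nhds (μ A)))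
    (hG_meas : ∀ k, AEStronglyMeasurable (G k) μ) (hG_bdd : ∀ k y, |G k y| ≤ C)
    (hG : ∀ᵐ y ∂μ.restrict A, Tendsto (fun k => G k y) atTop (nhds (H y))) :
    Tendsto (fun k => ∫ y in B k, G k y ∂μ) atTop (nhds (∫ y in A, H y ∂μ)) := by
  have hconst (c : ℝ) : Integrable (fun _ => c) (μ.restrict A) := integrableOn_const hA_fin
  have hinter : Tendsto (fun k => ∫ y in A, (B k).indicator (G k) y ∂μ) atTop
      (nhds (∫ y in A, H y ∂μ)) := by
    refine tendsto_integral_of_dominated_convergence (fun _ => C)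
      (fun k => ((hG_meas k).indicator (hB k)).restrict) (hconst C)
      (fun k => ae_of_all _ fun y => ?_) ?_
    · exact (norm_indicator_le_norm_self _ _).trans (hG_bdd k y)
    · filter_upwards [hmem, hG] with y hy hGy
      refine hGy.congr' ?_
      filter_upwards [hy] with k hk
      rw [indicator_of_mem hk]
  have hinter_meas : Tendsto (fun k => μ.real (A ∩ B k)) atTop (nhds (μ.real A)) := by
    have h : Tendsto (fun k => ∫ y in A, (B k).indicator (fun _ => (1 : ℝ)) y ∂μ) atTop
        (nhds (∫ y in A, (1 : ℝ) ∂μ)) := by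
      refine tendsto_integral_of_dominated_convergence (fun _ => 1)
        (fun k => (aestronglyMeasurable_const.indicator (hB k))) (hconst 1)
        (fun k => ae_of_all _ fun y => ?_) ?_
      · exact (norm_indicator_le_norm_self _ _).trans (by simp)
      · filter_upwards [hmem] with y hy
        refine tendsto_const_nhds.congr' ?_
        filter_upwards [hy] with k hk
        rw [indicator_of_mem hk]
    simpa [setIntegral_indicator (hB _)] using h
  have hB_fin : ∀ᶠ k in atTop, μ (B k) ≠ ⊤ := hmeas.eventually_ne hA_fin
  have hdiff_meas : Tendsto (fun k => C * μ.real (B k \ A)) atTop (nhds 0) := by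
    have h := (((ENNReal.tendsto_toReal hA_fin).comp hmeas).sub hinter_meas).const_mul C
    rw [← measureReal_def, sub_self, mul_zero] at h
    refine h.congr' ?_
    filter_upwards [hB_fin] with k hk
    have := measureReal_inter_add_sdiff (μ := μ) (s := B k) hA hk
    rw [inter_comm] at this
    simp only [Function.comp_apply, ← measureReal_def]
    rw [← this]
    ring
  have hdiff : Tendsto (fun k => ∫ y in B k \ A, G k y ∂μ) atTop (nhds 0) := by
    refine squeeze_zero_norm' ?_ hdiff_meas
    filter_upwards [hB_fin] with k hk
    exact norm_setIntegral_le_of_norm_le_const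
      ((measure_mono sdiff_subset).trans_lt hk.lt_top) fun y _ => hG_bdd k y
  have hsum := hinter.add hdiff
  rw [add_zero] at hsum
  refine hsum.congr' ?_
  filter_upwards [hB_fin] with k hk
  have hint : IntegrableOn (G k) (B k) μ :=
    IntegrableOn.of_bound hk.lt_top (hG_meas k).restrict C (ae_of_all _ fun y => hG_bdd k y)
  rw [setIntegral_indicator (hB k), inter_comm, integral_inter_add_sdiff hA hint]

/-- A weighted integral of `h` over a set where `|h - a| ≤ ε` differs from `a` times the total
weight by at most `ε` times the total weight. -/
theorem abs_setIntegral_mul_sub_le {α : Type*} [MeasurableSpace α] {μ : Measure α}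
    {A : Set α} {w h : α → ℝ} {a ε : ℝ} (hA : MeasurableSet A)
    (hw : IntegrableOn w A μ) (hwh : IntegrableOn (fun y => w y * h y) A μ)
    (hw_nonneg : ∀ y, 0 ≤ w y) (hh : ∀ y ∈ A, |h y - a| ≤ ε) :
    |(∫ y in A, w y * h y ∂μ) - a * ∫ y in A, w y ∂μ| ≤ ε * ∫ y in A, w y ∂μ := by
  rw [← integral_const_mul, ← integral_const_mul, ← integral_sub hwh (hw.const_mul a),
    ← Real.norm_eq_abs]
  refine norm_integral_le_of_norm_le (hw.const_mul ε) ?_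
  filter_upwards [ae_restrict_mem hA] with y hy
  rw [Real.norm_eq_abs, mul_comm a, ← mul_sub, abs_mul, abs_of_nonneg (hw_nonneg y), mul_comm]
  exact mul_le_mul_of_nonneg_right (hh y hy) (hw_nonneg y)

theorem measurableSet_Bstar {d : ℕ} {f : EuclideanSpace ℝ (Fin d) → ℝ} (hf : Continuous f)
    (ε : ℝ) (x : EuclideanSpace ℝ (Fin d)) : MeasurableSet (Bstar f ε x) :=
  (isOpen_lt (by fun_prop) continuous_const).measurableSet

theorem measurableSet_Bfam {d M : ℕ} {g : Fin M → EuclideanSpace ℝ (Fin d) → ℝ}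
    (hg : ∀ m, Continuous (g m)) (ε : ℝ) (x : EuclideanSpace ℝ (Fin d)) :
    MeasurableSet (Bfam g ε x) := by
  simp only [Bfam, ofPred_forall]
  exact MeasurableSet.iInter fun m => measurableSet_Bstar (hg m) ε x

/-- Smoothed version:
`lim_{ε→0} lim_{k→∞} (1/μ(B_k(ε,x))) ∫_{B_k(ε,x)} Π_m K[(f_{m,k}(t) − f_{m,k}(x))/ε] f(t) dt = f(x)`,
stated in iterated ε–δ form. -/
theorem stmt13
    {d M : ℕ} (hM : 0 < M)
    -- f : a bounded continuous density on ℝ^d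
    (f : EuclideanSpace ℝ (Fin d) → ℝ) (hf_cont : Continuous f) (hf_nonneg : ∀ y, 0 ≤ f y)
    (hf_int : ∫ y, f y = 1) (hf_bdd : ∃ C, ∀ y, f y ≤ C)
    -- K : a bounded continuous kernel with values in [0, c₂]
    (K : ℝ → ℝ) (c₂ : ℝ) (hK_cont : Continuous K) (hK_range : ∀ t, K t ∈ Icc 0 c₂)
    (x : EuclideanSpace ℝ (Fin d))
    (ε₀ : ℝ) (hε₀ : 0 < ε₀)
    (hvol : ∀ ε : ℝ, 0 < ε → ε < ε₀ → 0 < volume (Bstar f ε x) ∧ volume (Bstar f ε x) < ⊤)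
    -- normalization assumption on K
    (hK_norm : Tendsto
      (fun ε => (1 / (volume (Bstar f ε x)).toReal)
        * ∫ t in Bstar f ε x, K ((f t - f x) / ε) ^ M)
      (nhdsWithin 0 (Ioi 0)) (nhds 1))
    -- the continuous approximating functions f_{m,k}
    (fk : ℕ → Fin M → EuclideanSpace ℝ (Fin d) → ℝ)
    (hfk_cont : ∀ k m, Continuous (fk k m))
    (hconv_ae : ∀ᵐ y ∂(volume : Measure (EuclideanSpace ℝ (Fin d))),
      ∀ m, Tendsto (fun k => fk k m y) atTop (nhds (f y)))
    (hconv_x : ∀ m, Tendsto (fun k => fk k m x) atTop (nhds (f x)))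
    (hB_vol : ∀ ε : ℝ, 0 < ε → ε < ε₀ →
      Tendsto (fun k => volume (Bfam (fk k) ε x)) atTop (nhds (volume (Bstar f ε x)))) :
    ∀ δ > (0 : ℝ), ∃ ε₁ > (0 : ℝ), ∀ ε : ℝ, 0 < ε → ε < ε₁ →
      ∃ k₀ : ℕ, ∀ k ≥ k₀,
        |(1 / (volume (Bfam (fk k) ε x)).toReal)
            * (∫ t in Bfam (fk k) ε x, (∏ m : Fin M, K ((fk k m t - fk k m x) / ε)) * f t)
          - f x| < δ := by
  obtain ⟨C, hC⟩ := hf_bdd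
  have hc₂ : 0 ≤ c₂ := (hK_range 0).1.trans (hK_range 0).2
  have hf_abs (y) : |f y| ≤ C := by rw [abs_of_nonneg (hf_nonneg y)]; exact hC y
  -- the inner limit
  have hinner (ε : ℝ) (hε : 0 < ε) (hεε₀ : ε < ε₀) :
      Tendsto (fun k => (1 / (volume (Bfam (fk k) ε x)).toReal)
          * ∫ t in Bfam (fk k) ε x, (∏ m : Fin M, K ((fk k m t - fk k m x) / ε)) * f t) atTop
        (nhds ((1 / (volume (Bstar f ε x)).toReal)
          * ∫ t in Bstar f ε x, K ((f t - f x) / ε) ^ M * f t)) := by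
    obtain ⟨hpos, hfin⟩ := hvol ε hε hεε₀
    have hinv : Tendsto (fun k => 1 / (volume (Bfam (fk k) ε x)).toReal) atTop
        (nhds (1 / (volume (Bstar f ε x)).toReal)) :=
      tendsto_const_nhds.div ((ENNReal.tendsto_toReal hfin.ne).comp (hB_vol ε hε hεε₀))
        (ENNReal.toReal_pos hpos.ne' hfin.ne).ne'
    refine hinv.mul (tendsto_setIntegral_of_tendsto_measure (C := c₂ ^ M * C)
      (measurableSet_Bstar hf_cont ε x) (fun k => measurableSet_Bfam (hfk_cont k) ε x) hfin.ne
      ?_ (hB_vol ε hε hεε₀) (fun k => ?_) (fun k y => ?_) ?_)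
    · filter_upwards [ae_restrict_of_ae hconv_ae,
        ae_restrict_mem (measurableSet_Bstar hf_cont ε x)] with y hy hyA
      exact eventually_all.2 fun m => ((hy m).sub (hconv_x m)).abs.eventually_lt_const hyA
    · have := hfk_cont k
      exact Continuous.aestronglyMeasurable (by fun_prop)
    · have hprod : |∏ m : Fin M, K ((fk k m y - fk k m x) / ε)| ≤ c₂ ^ M := by
        rw [abs_of_nonneg (Finset.prod_nonneg fun m _ => (hK_range _).1)]
        simpa using Finset.prod_le_prod (s := Finset.univ) (g := fun _ : Fin M => c₂)
          (fun m _ => (hK_range ((fk k m y - fk k m x) / ε)).1) fun m _ => (hK_range _).2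
      rw [abs_mul]
      exact mul_le_mul hprod (hf_abs y) (abs_nonneg _) (by positivity)
    · filter_upwards [ae_restrict_of_ae hconv_ae] with y hy
      refine Tendsto.mul_const _ ?_
      have := tendsto_finsetProd (Finset.univ : Finset (Fin M)) fun m _ =>
        (hK_cont.tendsto _).comp (((hy m).sub (hconv_x m)).div_const ε)
      simpa using this
  -- the outer limit
  have houter : Tendsto (fun ε => (1 / (volume (Bstar f ε x)).toReal)
      * ∫ t in Bstar f ε x, K ((f t - f x) / ε) ^ M * f t)
      (nhdsWithin 0 (Ioi 0)) (nhds (f x)) := by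
    have hid : Tendsto (fun ε : ℝ => ε) (nhdsWithin 0 (Ioi 0)) (nhds 0) :=
      tendsto_id.mono_left nhdsWithin_le_nhds
    have hbound := hid.mul hK_norm
    have hmain := hK_norm.const_mul (f x)
    rw [zero_mul] at hbound
    rw [mul_one] at hmain
    have hdiff := squeeze_zero_norm' (f := fun ε => (1 / (volume (Bstar f ε x)).toReal)
      * (∫ t in Bstar f ε x, K ((f t - f x) / ε) ^ M * f t)
      - f x * ((1 / (volume (Bstar f ε x)).toReal)
        * ∫ t in Bstar f ε x, K ((f t - f x) / ε) ^ M)) ?_ hbound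
    · simpa using hdiff.add hmain
    filter_upwards [Ioo_mem_nhdsGT hε₀] with ε ⟨hε, hεε₀⟩
    have hfin := (hvol ε hε hεε₀).2
    have hw (y) : |K ((f y - f x) / ε) ^ M| ≤ c₂ ^ M := by
      rw [abs_of_nonneg (pow_nonneg (hK_range _).1 _)]
      exact pow_le_pow_left₀ (hK_range _).1 (hK_range _).2 _
    have h := abs_setIntegral_mul_sub_le (μ := volume) (w := fun y => K ((f y - f x) / ε) ^ M)
      (h := f) (a := f x) (ε := ε) (measurableSet_Bstar hf_cont ε x)
      (IntegrableOn.of_bound hfin (Continuous.aestronglyMeasurable (by fun_prop)) (c₂ ^ M)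
        (ae_of_all _ hw))
      (IntegrableOn.of_bound hfin (Continuous.aestronglyMeasurable (by fun_prop)) (c₂ ^ M * C)
        (ae_of_all _ fun y => by
          rw [Real.norm_eq_abs, abs_mul]
          exact mul_le_mul (hw y) (hf_abs y) (abs_nonneg _) (by positivity)))
      (fun y => pow_nonneg (hK_range _).1 _) (fun y hy => le_of_lt hy)
    have hV : 0 ≤ 1 / (volume (Bstar f ε x)).toReal := by positivity
    rw [Real.norm_eq_abs, mul_left_comm (f x), ← mul_sub, abs_mul, abs_of_nonneg hV,
      mul_left_comm ε]
    exact mul_le_mul_of_nonneg_left h hV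
  intro δ hδ
  have hev := houter.eventually (Metric.ball_mem_nhds _ hδ)
  obtain ⟨ε₁, hε₁, hsub⟩ := mem_nhdsGT_iff_exists_Ioo_subset.1 hev
  refine ⟨min ε₁ ε₀, lt_min hε₁ hε₀, fun ε hε hlt => ?_⟩
  have hball := hsub ⟨hε, hlt.trans_le (min_le_left _ _)⟩
  exact eventually_atTop.1 <| (hinner ε hε (hlt.trans_le (min_le_right _ _))).eventually
    (Metric.isOpen_ball.mem_nhds hball)
end
end

section
/- Let f be a bounded density on ℝ^d, P_X the probability measure with density f, and x a point with f(x) > 0 such that μ({y : f(y) = f(x)}) = 0 and 0 < μ(B*(ε,x)) < ∞ for all sufficiently small ε > 0. If ε_l → 0, then √(μ(B*(ε_l,x))) / √(P_X(B*(ε_l,x))·(1 − P_X(B*(ε_l,x)))) → 1/√(f(x)) as l → ∞. -/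
open MeasureTheory Filter Set

noncomputable section

theorem tendsto_volume_Bstar {d : ℕ} {f : EuclideanSpace ℝ (Fin d) → ℝ} (hf : Measurable f)
    (x : EuclideanSpace ℝ (Fin d)) (hfin : ∃ ε > 0, volume (Bstar f ε x) ≠ ⊤) :
    Tendsto (fun ε => volume (Bstar f ε x)) (nhdsWithin 0 (Ioi 0))
      (nhds (volume {y | f y = f x})) := by
  have hinter : ⋂ ε > (0 : ℝ), Bstar f ε x = {y | f y = f x} := by
    ext y
    simp only [mem_iInter, Bstar, mem_ofPred_eq]
    constructor
    · intro h
      by_contra hne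
      exact lt_irrefl _ (h _ (abs_pos.2 (sub_ne_zero.2 hne)))
    · intro h ε hε
      simpa [h] using hε
  rw [← hinter]
  refine tendsto_measure_biInter_gt (fun ε _ => ?_) (fun i j _ hij y hy => ?_) hfin
  · exact (measurableSet_lt (hf.sub_const (f x)).abs measurable_const).nullMeasurableSet
  · exact lt_of_lt_of_le hy hij

theorem abs_setIntegral_Bstar_sub_le {d : ℕ} {f : EuclideanSpace ℝ (Fin d) → ℝ}
    (hf : Integrable f) (x : EuclideanSpace ℝ (Fin d)) {ε : ℝ}
    (hfin : volume (Bstar f ε x) < ⊤) :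
    |(∫ t in Bstar f ε x, f t) - (volume (Bstar f ε x)).toReal * f x|
      ≤ ε * (volume (Bstar f ε x)).toReal := by
  have hconst : IntegrableOn (fun _ => f x) (Bstar f ε x) := integrableOn_const hfin.ne
  have h := norm_setIntegral_le_of_norm_le_const (f := fun t => f t - f x) (C := ε) hfin
    (fun t ht => le_of_lt ht)
  rwa [integral_sub hf.integrableOn hconst, setIntegral_const, smul_eq_mul] at h

/-- `√μ(B*(ε_l,x)) / √(P_X(B*(ε_l,x))(1 − P_X(B*(ε_l,x)))) → 1/√f(x)` as `l → ∞`. -/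
theorem stmt15
    {d : ℕ}
    -- f : a bounded density on ℝ^d
    (f : EuclideanSpace ℝ (Fin d) → ℝ) (hf_meas : Measurable f) (hf_nonneg : ∀ y, 0 ≤ f y)
    (hf_int : ∫ y, f y = 1) (hf_bdd : ∃ C, ∀ y, f y ≤ C)
    (x : EuclideanSpace ℝ (Fin d)) (hfx : 0 < f x)
    (hlevel : volume {y : EuclideanSpace ℝ (Fin d) | f y = f x} = 0)
    (ε₀ : ℝ) (hε₀ : 0 < ε₀)
    (hvol : ∀ ε : ℝ, 0 < ε → ε < ε₀ → 0 < volume (Bstar f ε x) ∧ volume (Bstar f ε x) < ⊤)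
    -- ε_l → 0
    (εl : ℕ → ℝ) (hεl_pos : ∀ l, 0 < εl l) (hεl : Tendsto εl atTop (nhds 0)) :
    Tendsto
      (fun l => Real.sqrt (volume (Bstar f (εl l) x)).toReal
        / Real.sqrt ((∫ t in Bstar f (εl l) x, f t) * (1 - ∫ t in Bstar f (εl l) x, f t)))
      atTop (nhds (1 / Real.sqrt (f x))) := by
  have hf : Integrable f := by
    by_contra h
    rw [integral_undef h] at hf_int
    exact zero_ne_one hf_int
  set V : ℕ → ℝ := fun l => (volume (Bstar f (εl l) x)).toReal
  set P : ℕ → ℝ := fun l => ∫ t in Bstar f (εl l) x, f t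
  have hsmall : ∀ᶠ l in atTop, εl l < ε₀ := hεl.eventually_lt_const hε₀
  have hVpos : ∀ᶠ l in atTop, 0 < V l := hsmall.mono fun l hl =>
    ENNReal.toReal_pos (hvol _ (hεl_pos l) hl).1.ne' (hvol _ (hεl_pos l) hl).2.ne
  have hV0 : Tendsto V atTop (nhds 0) := by
    have h := tendsto_volume_Bstar hf_meas x
      ⟨ε₀ / 2, half_pos hε₀, (hvol _ (half_pos hε₀) (half_lt_self hε₀)).2.ne⟩
    rw [hlevel] at h
    have h' := h.comp (tendsto_nhdsWithin_iff.2 ⟨hεl, Eventually.of_forall hεl_pos⟩)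
    exact (ENNReal.tendsto_toReal ENNReal.zero_ne_top).comp h'
  have hratio : Tendsto (fun l => P l / V l) atTop (nhds (f x)) := by
    rw [tendsto_iff_dist_tendsto_zero]
    refine squeeze_zero' (Eventually.of_forall fun _ => dist_nonneg) ?_ hεl
    filter_upwards [hsmall, hVpos] with l hl hpos
    rw [Real.dist_eq, div_sub' hpos.ne', abs_div, abs_of_pos hpos, div_le_iff₀ hpos]
    exact abs_setIntegral_Bstar_sub_le hf x (hvol _ (hεl_pos l) hl).2
  have hP0 : Tendsto P atTop (nhds 0) := by
    have h := hratio.mul hV0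
    rw [mul_zero] at h
    exact h.congr' (hVpos.mono fun l hl => div_mul_cancel₀ _ hl.ne')
  have hmain : Tendsto (fun l => √(P l / V l * (1 - P l))) atTop (nhds √(f x)) := by
    simpa using (hratio.mul (hP0.const_sub 1)).sqrt
  have hinv := hmain.inv₀ (Real.sqrt_pos.2 hfx).ne'
  rw [one_div]
  refine hinv.congr' (hVpos.mono fun l hl => ?_)
  change _ = √(V l) / √(P l * (1 - P l))
  rw [div_mul_eq_mul_div, Real.sqrt_div' _ hl.le, inv_div]
end
end

section
/- Let f be a bounded density on ℝ^d, P_X the probability measure with density f, and x a point with f(x) > 0 such that μ(B*(ε,x)) < ∞ for all sufficiently small ε > 0. Let ε_l → 0 with l·ε_l² → 0, and for each l and k let B_k(ε_l,x) be measurable sets with μ(B_k(ε_l,x)) → μ(B*(ε_l,x)) and P_X(B_k(ε_l,x)) → P_X(B*(ε_l,x)) as k → ∞, with 0 < μ(B*(ε_l,x)). Then lim_{l→∞} lim_{k→∞} √(μ(B*(ε_l,x))·l)·[P_X(B_k(ε_l,x))/μ(B_k(ε_l,x)) − f(x)] = 0; in particular lim_{l→∞} lim_{k→∞} P_X(B_k(ε_l,x))/μ(B_k(ε_l,x))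 = f(x). -/
open MeasureTheory Filter Set

noncomputable section

theorem Bstar_mono {d : ℕ} (f : EuclideanSpace ℝ (Fin d) → ℝ) (x : EuclideanSpace ℝ (Fin d))
    {ε ε' : ℝ} (h : ε ≤ ε') : Bstar f ε x ⊆ Bstar f ε' x :=
  fun _ hy => lt_of_lt_of_le hy h

/-- The average of `f` over `B*(ε,x)` differs from `f x` by at most `ε`. -/
theorem abs_setIntegral_Bstar_div_sub_le {d : ℕ} {f : EuclideanSpace ℝ (Fin d) → ℝ}
    (hfi : Integrable f) (x : EuclideanSpace ℝ (Fin d)) {ε : ℝ}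
    (hpos : 0 < volume (Bstar f ε x)) (hfin : volume (Bstar f ε x) < ⊤) :
    |(∫ t in Bstar f ε x, f t) / (volume (Bstar f ε x)).toReal - f x| ≤ ε := by
  have hm : 0 < (volume (Bstar f ε x)).toReal := ENNReal.toReal_pos hpos.ne' hfin.ne
  have hdiff : ∫ t in Bstar f ε x, (f t - f x) =
      (∫ t in Bstar f ε x, f t) - f x * (volume (Bstar f ε x)).toReal := by
    rw [integral_sub hfi.integrableOn (integrableOn_const hfin.ne), setIntegral_const, smul_eq_mul,
      mul_comm, measureReal_def]
  have hle : ‖∫ t in Bstar f ε x, (f t - f x)‖ ≤ ε * volume.real (Bstar f ε x) :=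
    norm_setIntegral_le_of_norm_le_const hfin fun y hy => le_of_lt hy
  rw [hdiff, Real.norm_eq_abs, measureReal_def] at hle
  rw [div_sub' hm.ne', abs_div, abs_of_pos hm, div_le_iff₀ hm, mul_comm _ (f x)]
  exact hle

/-- `lim_{l→∞} lim_{k→∞} √(μ(B*(ε_l,x))·l)[P_X(B_k(ε_l,x))/μ(B_k(ε_l,x)) − f(x)] = 0`, and
in particular `lim_{l→∞} lim_{k→∞} P_X(B_k(ε_l,x))/μ(B_k(ε_l,x)) = f(x)`; iterated ε–δ form. -/
theorem stmt17
    {d : ℕ}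
    -- f : a bounded density on ℝ^d
    (f : EuclideanSpace ℝ (Fin d) → ℝ) (hf_meas : Measurable f) (hf_nonneg : ∀ y, 0 ≤ f y)
    (hf_int : ∫ y, f y = 1) (hf_bdd : ∃ C, ∀ y, f y ≤ C)
    (x : EuclideanSpace ℝ (Fin d)) (hfx : 0 < f x)
    (ε₀ : ℝ) (hε₀ : 0 < ε₀)
    (hfin : ∀ ε : ℝ, 0 < ε → ε < ε₀ → volume (Bstar f ε x) < ⊤)
    -- ε_l → 0 with l·ε_l² → 0
    (εl : ℕ → ℝ) (hεl_pos : ∀ l, 0 < εl l) (hεl : Tendsto εl atTop (nhds 0))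
    (hεl2 : Tendsto (fun l : ℕ => (l : ℝ) * εl l ^ 2) atTop (nhds 0))
    (hstar_pos : ∀ l, 0 < volume (Bstar f (εl l) x))
    -- the approximating measurable sets B_k(ε_l,x)
    (B : ℕ → ℕ → Set (EuclideanSpace ℝ (Fin d)))
    (hB_meas : ∀ k l, MeasurableSet (B k l))
    (hB_vol : ∀ l, Tendsto (fun k => volume (B k l)) atTop (nhds (volume (Bstar f (εl l) x))))
    (hB_int : ∀ l, Tendsto (fun k => ∫ t in B k l, f t) atTop
      (nhds (∫ t in Bstar f (εl l) x, f t))) :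
    (∀ δ > (0 : ℝ), ∃ L : ℕ, ∀ l ≥ L, ∃ k₀ : ℕ, ∀ k ≥ k₀,
      |Real.sqrt ((volume (Bstar f (εl l) x)).toReal * l)
          * ((∫ t in B k l, f t) / (volume (B k l)).toReal - f x)| < δ) ∧
    (∀ δ > (0 : ℝ), ∃ L : ℕ, ∀ l ≥ L, ∃ k₀ : ℕ, ∀ k ≥ k₀,
      |(∫ t in B k l, f t) / (volume (B k l)).toReal - f x| < δ) := by
  have hfi : Integrable f := by
    by_contra h
    simp [integral_undef h] at hf_int
  set m : ℕ → ℝ := fun l => (volume (Bstar f (εl l) x)).toReal with hm_def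
  set M : ℝ := (volume (Bstar f (ε₀ / 2) x)).toReal
  have hM : volume (Bstar f (ε₀ / 2) x) < ⊤ := hfin _ (half_pos hε₀) (half_lt_self hε₀)
  have hsmall : ∀ᶠ l in atTop, εl l < ε₀ / 2 := hεl.eventually_lt_const (half_pos hε₀)
  have hfin_l : ∀ᶠ l in atTop, volume (Bstar f (εl l) x) < ⊤ := by
    filter_upwards [hsmall] with l hl
    exact (measure_mono (Bstar_mono f x hl.le)).trans_lt hM
  have hmM : ∀ᶠ l in atTop, m l ≤ M := by
    filter_upwards [hsmall] with l hl
    exact ENNReal.toReal_mono hM.ne (measure_mono (Bstar_mono f x hl.le))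
  have hlim : ∀ l, volume (Bstar f (εl l) x) < ⊤ →
      Tendsto (fun k => (∫ t in B k l, f t) / (volume (B k l)).toReal - f x) atTop
        (nhds ((∫ t in Bstar f (εl l) x, f t) / m l - f x)) := fun l hl =>
    ((hB_int l).div ((ENNReal.tendsto_toReal hl.ne).comp (hB_vol l))
      (ENNReal.toReal_pos (hstar_pos l).ne' hl.ne).ne').sub_const _
  have hbound : Tendsto (fun l : ℕ => √(M * (l * εl l ^ 2))) atTop (nhds 0) := by
    simpa using (hεl2.const_mul M).sqrt
  refine ⟨fun δ hδ => eventually_atTop.1 ?_, fun δ hδ => eventually_atTop.1 ?_⟩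
  · filter_upwards [hfin_l, hmM, hbound.eventually_lt_const hδ] with l hl hml hlδ
    refine eventually_atTop.1 (((hlim l hl).const_mul (√(m l * l))).abs.eventually_lt_const ?_)
    refine lt_of_le_of_lt ?_ hlδ
    rw [abs_mul, abs_of_nonneg (Real.sqrt_nonneg _)]
    calc √(m l * l) * |(∫ t in Bstar f (εl l) x, f t) / m l - f x|
        ≤ √(m l * l) * εl l := by
          gcongr
          exact abs_setIntegral_Bstar_div_sub_le hfi x (hstar_pos l) hl
      _ = √(m l * (l * εl l ^ 2)) := by
          rw [← mul_assoc, Real.sqrt_mul' _ (sq_nonneg _), Real.sqrt_sq (hεl_pos l).le]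
      _ ≤ √(M * (l * εl l ^ 2)) := by gcongr
  · filter_upwards [hfin_l, hεl.eventually_lt_const hδ] with l hl hlδ
    exact eventually_atTop.1 ((hlim l hl).abs.eventually_lt_const
      ((abs_setIntegral_Bstar_div_sub_le hfi x (hstar_pos l) hl).trans_lt hlδ))
end
end
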